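/- Let v, β : ℝ³ → ℝ³ be differentiable at a point x, let γ ∈ ℝ and ρ₀ ≥ 0, and suppose the smallest eigenvalue of the real symmetric effective reaction matrix M(x) := (γ − (1/2) div β(x)) I + (1/2)(J_β(x) + J_β(x)ᵀ) is at least ρ₀ (equivalently, (M(x)z)·z ≥ ρ₀‖z‖² for all z ∈ ℝ³). Then (L_β v)(x) · v(x) + γ ‖v(x)‖² ≥ ρ₀ ‖v(x)‖² + (1/2) div(‖v‖² β)(x), where ‖v‖²β denotes the vector field y ↦ ‖v(y)‖² β(y). -/

import Mathlib

open Matrix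

/-- `∂ᵢFⱼ(x)`: the `j`-th component of the Fréchet derivative of `F` at `x`
applied to the `i`-th standard basis vector. -/
noncomputable def pdv (F : (Fin 3 → ℝ) → (Fin 3 → ℝ)) (x : Fin 3 → ℝ) (i j : Fin 3) : ℝ :=
  fderiv ℝ F x (Pi.single i 1) j

/-- `∂ᵢf(x)` for a scalar function `f`. -/
noncomputable def pds (f : (Fin 3 → ℝ) → ℝ) (x : Fin 3 → ℝ) (i : Fin 3) : ℝ :=
  fderiv ℝ f x (Pi.single i 1)

/-- `curl F(x) = (∂₂F₃ − ∂₃F₂, ∂₃F₁ − ∂₁F₃, ∂₁F₂ − ∂₂F₁)` (zero-based indices). -/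
noncomputable def curl3 (F : (Fin 3 → ℝ) → (Fin 3 → ℝ)) (x : Fin 3 → ℝ) : Fin 3 → ℝ :=
  ![pdv F x 1 2 - pdv F x 2 1, pdv F x 2 0 - pdv F x 0 2, pdv F x 0 1 - pdv F x 1 0]

/-- `div F(x) = ∂₁F₁ + ∂₂F₂ + ∂₃F₃`. -/
noncomputable def div3 (F : (Fin 3 → ℝ) → (Fin 3 → ℝ)) (x : Fin 3 → ℝ) : ℝ :=
  pdv F x 0 0 + pdv F x 1 1 + pdv F x 2 2

/-- `grad f(x) = (∂₁f, ∂₂f, ∂₃f)(x)`. -/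
noncomputable def grad3 (f : (Fin 3 → ℝ) → ℝ) (x : Fin 3 → ℝ) : Fin 3 → ℝ :=
  ![pds f x 0, pds f x 1, pds f x 2]

/-- The Jacobian matrix `(J_F(x))ᵢⱼ = ∂ⱼFᵢ(x)`. -/
noncomputable def jac3 (F : (Fin 3 → ℝ) → (Fin 3 → ℝ)) (x : Fin 3 → ℝ) :
    Matrix (Fin 3) (Fin 3) ℝ :=
  Matrix.of fun i j => pdv F x j i

/-- The magnetic (Lie) advection `L_β u := −β × (curl u) + grad(β·u)`. -/
noncomputable def Lie (β u : (Fin 3 → ℝ) → (Fin 3 → ℝ)) (x : Fin 3 → ℝ) : Fin 3 → ℝ :=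
  -(β x ⨯₃ curl3 u x) + grad3 (fun y => β y ⬝ᵥ u y) x

/-- The formal dual of the magnetic advection `𝓛_β v := curl(β×v) − (div v)·β`. -/
noncomputable def LieDual (β v : (Fin 3 → ℝ) → (Fin 3 → ℝ)) (x : Fin 3 → ℝ) : Fin 3 → ℝ :=
  curl3 (fun y => β y ⨯₃ v y) x - div3 v x • β x

theorem hasFDerivAt_dot_aux (u w : (Fin 3 → ℝ) → (Fin 3 → ℝ)) (x : Fin 3 → ℝ)
    (hu : DifferentiableAt ℝ u x) (hw : DifferentiableAt ℝ w x) :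
    DifferentiableAt ℝ (fun y => u y ⬝ᵥ w y) x ∧ ∀ i : Fin 3,
      pds (fun y => u y ⬝ᵥ w y) x i =
        ∑ j : Fin 3, (u x j * pdv w x i j + w x j * pdv u x i j) := by
  have hu' := hasFDerivAt_pi'.1 hu.hasFDerivAt
  have hw' := hasFDerivAt_pi'.1 hw.hasFDerivAt
  have h : HasFDerivAt (fun y => u y ⬝ᵥ w y) _ x :=
    HasFDerivAt.fun_sum (u := Finset.univ) (fun j _ => (hu' j).mul (hw' j))
  refine ⟨h.differentiableAt, fun i => ?_⟩
  unfold pds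
  rw [h.fderiv]
  simp [pdv]

theorem pdv_smul_aux (f : (Fin 3 → ℝ) → ℝ) (w : (Fin 3 → ℝ) → (Fin 3 → ℝ)) (x : Fin 3 → ℝ)
    (hf : DifferentiableAt ℝ f x) (hw : DifferentiableAt ℝ w x) (i j : Fin 3) :
    pdv (fun y => f y • w y) x i j = f x * pdv w x i j + pds f x i * w x j := by
  unfold pdv pds
  rw [(hf.hasFDerivAt.fun_smul hw.hasFDerivAt).fderiv]
  simp

/-- Degenerate Friedrichs bound: if the effective reaction matrix
`M(x) = (γ − (1/2)div β(x)) I + (1/2)(J_β(x) + J_β(x)ᵀ)` satisfies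
`(M z)·z ≥ ρ₀‖z‖²` for all `z` with `ρ₀ ≥ 0`, then
`(L_β v)·v + γ‖v‖² ≥ ρ₀‖v‖² + (1/2) div(‖v‖²β)`. -/
theorem lie_energy_lower_bound (v β : (Fin 3 → ℝ) → (Fin 3 → ℝ)) (x : Fin 3 → ℝ)
    (γ ρ₀ : ℝ) (hρ₀ : 0 ≤ ρ₀)
    (hv : DifferentiableAt ℝ v x) (hβ : DifferentiableAt ℝ β x)
    (hM : ∀ z : Fin 3 → ℝ,
      ρ₀ * (z ⬝ᵥ z) ≤
        (((γ - div3 β x / 2) • (1 : Matrix (Fin 3) (Fin 3) ℝ)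
            + (1 / 2 : ℝ) • (jac3 β x + (jac3 β x)ᵀ)).mulVec z) ⬝ᵥ z) :
    ρ₀ * (v x ⬝ᵥ v x) + (1 / 2) * div3 (fun y => (v y ⬝ᵥ v y) • β y) x ≤
      Lie β v x ⬝ᵥ v x + γ * (v x ⬝ᵥ v x) := by
  have h := hM (v x)
  obtain ⟨hd, hvv⟩ := hasFDerivAt_dot_aux v v x hv hv
  obtain ⟨-, hbv⟩ := hasFDerivAt_dot_aux β v x hβ hv
  have e := fun i j => pdv_smul_aux _ _ _ hd hβ i j
  simp only [hvv] at e
  have e' : div3 (fun y => (v y ⬝ᵥ v y) • β y) x = _ :=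
    congrArg₂ (· + ·) (congrArg₂ (· + ·) (e 0 0) (e 1 1)) (e 2 2)
  rw [e']
  simp only [Lie, grad3, hbv]
  simp only [Matrix.add_mulVec, Matrix.smul_mulVec, Matrix.one_mulVec] at h
  simp only [curl3, div3, jac3, cross_apply, dotProduct, Matrix.mulVec, Fin.sum_univ_three,
    Pi.add_apply, Pi.neg_apply, Pi.smul_apply, smul_eq_mul, Matrix.transpose_apply,
    Matrix.of_apply, Matrix.cons_val] at h ⊢
  linarith
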